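/- Let V be a weak lower perfect space with lower perfect basis B. For any (i,l) ∈ I^∞ and n ∈ ℤ_{≥0}, the subspace 𝚏_{il}^n V has basis 𝐟_{il}^n(B) \ {0}; that is, 𝚏_{il}^n V = ⊕_{b ∈ 𝐟_{il}^n(B)\{0}} k·b, where 𝐟_{il}^n(B) denotes the set of n-fold applications of the map 𝐟_{il} to elements of B. -/

import Mathlib

noncomputable section

open Function Set

/-- An even symmetrizable Borcherds–Cartan datum: a countable index set `I`, an
even symmetrizable Borcherds–Cartan matrix `a`, a symmetrizing diagonal `s`,
a free abelian weight lattice `P` and linearly independent simple roots `α`. -/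
structure BCDatum (I : Type*) (P : Type*) [AddCommGroup P] where
  a : I → I → ℤ
  s : I → ℤ
  α : I → P
  countable_index : Countable I
  even_diag : ∀ i, Even (a i i)
  diag_le_two : ∀ i, a i i ≤ 2
  offdiag_nonpos : ∀ i j, i ≠ j → a i j ≤ 0
  s_pos : ∀ i, 0 < s i
  symmetrizable : ∀ i j, s i * a i j = s j * a j i
  free_weight : Module.Free ℤ P
  roots_indep : LinearIndependent ℤ α

namespace BCDatum

variable {I P : Type*} [AddCommGroup P] (D : BCDatum I P)

/-- `I^∞ = I^re ⊔ (I^im × ℤ_{>0})`. -/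
abbrev Iinf : Type _ := {i : I // D.a i i = 2} ⊕ ({i : I // D.a i i ≤ 0} × ℕ+)

/-- The weight `l·α_i` attached to an element of `I^∞` (with `l = 1` in the real case). -/
def wtOf (x : D.Iinf) : P :=
  Sum.elim (fun i => D.α i.1) (fun p => (p.2 : ℕ) • D.α p.1.1) x

/-- `R_+ = Σ_i ℤ_{≥0} α_i`. -/
def Rplus : Set P := {μ | ∃ c : I →₀ ℕ, μ = c.sum fun i n => n • D.α i}

end BCDatum

/-- A good sequence of indices: every element of `I^∞` appears infinitely often. -/
def GoodIdxSeq {I P : Type*} [AddCommGroup P] {D : BCDatum I P} (gi : ℕ → D.Iinf) : Prop :=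
  ∀ x : D.Iinf, ∀ N : ℕ, ∃ n, N ≤ n ∧ gi n = x

/-- Lexicographic strict order on integer sequences: `SeqLt a b` means `a < b`. -/
def SeqLt (a b : ℕ → ℕ) : Prop := ∃ m, (∀ s, s < m → a s = b s) ∧ a m < b m

/-- Lexicographic order: `SeqLe a b` means `a ≤ b`. -/
def SeqLe (a b : ℕ → ℕ) : Prop := a = b ∨ SeqLt a b

/-- A good sequence of nonnegative integers: eventually zero. -/
def GoodNatSeq (a : ℕ → ℕ) : Prop := ∃ N, ∀ n, N ≤ n → a n = 0

/-- A weak lower perfect space over a Borcherds–Cartan datum `D`: a `P`-graded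
`k`-vector space with finite dimensional weight spaces, weights bounded by
finitely many `λ_j - R_+`, together with endomorphisms `f x = 𝚏_{il}`
lowering the weight by `l·α_i`. -/
structure WeakLowerPerfect {I P : Type*} [AddCommGroup P] (D : BCDatum I P)
    (k : Type*) [Field k] (V : Type*) [AddCommGroup V] [Module k V] where
  wtSp : P → Submodule k V
  wt_indep : iSupIndep wtSp
  wt_total : ⨆ μ, wtSp μ = ⊤
  wt_findim : ∀ μ, FiniteDimensional k (wtSp μ)
  wt_bdd : ∃ Λ : Finset P, ∀ μ, wtSp μ ≠ ⊥ → ∃ lam ∈ Λ, ∃ β ∈ D.Rplus, μ = lam - β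
  f : D.Iinf → Module.End k V
  f_wt : ∀ x μ, ∀ v ∈ wtSp μ, f x v ∈ wtSp (μ - D.wtOf x)

namespace WeakLowerPerfect

variable {I P : Type*} [AddCommGroup P] {D : BCDatum I P}
  {k : Type*} [Field k] {V : Type*} [AddCommGroup V] [Module k V]

/-- `d_{il}(v)`: the largest `n` with `v ∈ 𝚏_{il}^n V` (for `v ≠ 0` in a weak
lower perfect space this is the unique `n` with `v ∈ 𝚏^n V \ 𝚏^{n+1} V`). -/
def d (W : WeakLowerPerfect D k V) (x : D.Iinf) (v : V) : ℕ :=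
  sSup {n | v ∈ LinearMap.range (W.f x ^ n)}

/-- The composite `𝚏_{i_1l_1}^{a_1} ⋯ 𝚏_{i_rl_r}^{a_r}` (`0`-based indexing). -/
def prodF (W : WeakLowerPerfect D k V) (gi : ℕ → D.Iinf) (a : ℕ → ℕ) (r : ℕ) :
    Module.End k V :=
  ((List.range r).map fun j => W.f (gi j) ^ a j).prod

/-- `V^{>𝐢,𝐚} = Σ_{k=1}^r 𝚏_{i_1l_1}^{a_1}⋯𝚏_{i_{k-1}l_{k-1}}^{a_{k-1}} 𝚏_{i_kl_k}^{a_k+1} V`. -/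
def Vgt (W : WeakLowerPerfect D k V) (gi : ℕ → D.Iinf) (a : ℕ → ℕ) (r : ℕ) :
    Submodule k V :=
  ⨆ j ∈ Finset.range r, LinearMap.range (W.prodF gi a j * W.f (gi j) ^ (a j + 1))

/-- `V^{≥𝐢,𝐚} = V^{>𝐢,𝐚} + 𝚏_{i_1l_1}^{a_1}⋯𝚏_{i_rl_r}^{a_r} V`. -/
def Vge (W : WeakLowerPerfect D k V) (gi : ℕ → D.Iinf) (a : ℕ → ℕ) (r : ℕ) :
    Submodule k V :=
  W.Vgt gi a r ⊔ LinearMap.range (W.prodF gi a r)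

end WeakLowerPerfect

/-- A lower perfect basis of a weak lower perfect space: a basis compatible with the
grading, equipped with crystal-type maps `𝐟_{il} : B → B ∪ {0}` approximating the
`𝚏_{il}` modulo `𝚏_{il}^{d_{il}(b)+2} V`, jointly injective. (The maps `flo` are
extended to all of `V`, with the convention `flo x 0 = 0`.) -/
structure LowerPerfectBasis {I P : Type*} [AddCommGroup P] {D : BCDatum I P}
    {k : Type*} [Field k] {V : Type*} [AddCommGroup V] [Module k V]
    (W : WeakLowerPerfect D k V) where
  B : Set V
  linIndep : LinearIndependent k (Subtype.val : B → V)
  spans : Submodule.span k B = ⊤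
  graded : ∀ b ∈ B, ∃ μ, b ∈ W.wtSp μ
  flo : D.Iinf → V → V
  flo_mem : ∀ x, ∀ b ∈ B, flo x b ∈ B ∨ flo x b = 0
  flo_zero : ∀ x, flo x 0 = 0
  flo_approx : ∀ x, ∀ b ∈ B, ∃ c : k, c ≠ 0 ∧
    W.f x b - c • flo x b ∈ LinearMap.range (W.f x ^ (W.d x b + 2))
  flo_joint_inj : ∀ b ∈ B, ∀ b' ∈ B, (∀ x, flo x b = flo x b') → b = b'

namespace LowerPerfectBasis

variable {I P : Type*} [AddCommGroup P] {D : BCDatum I P}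
  {k : Type*} [Field k] {V : Type*} [AddCommGroup V] [Module k V]
  {W : WeakLowerPerfect D k V}

open Classical in
/-- `𝐞_{il} : B → B ∪ {0}`: `𝐞_{il}(b) = b'` if `b = 𝐟_{il}(b')` with `b' ∈ B`,
and `𝐞_{il}(b) = 0` otherwise. -/
def elo (L : LowerPerfectBasis W) (x : D.Iinf) (b : V) : V :=
  if h : b ∈ L.B ∧ ∃ b' ∈ L.B, L.flo x b' = b then h.2.choose else 0

/-- `𝐞_{il}^{top}(b) = 𝐞_{il}^{d_{il}(b)}(b)`. -/
def etop (L : LowerPerfectBasis W) (x : D.Iinf) (b : V) : V :=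
  (L.elo x)^[W.d x b] b

/-- The sequence `b_0 = b`, `b_{k+1} = 𝐞_{i_{k+1}l_{k+1}}^{top}(b_k)` (0-based). -/
def bseq (L : LowerPerfectBasis W) (gi : ℕ → D.Iinf) (b : V) (n : ℕ) : V :=
  Nat.rec (motive := fun _ => V) b (fun m prev => L.etop (gi m) prev) n

/-- The sequence `𝐝(𝐢,b)`: `d_k = d_{i_kl_k}(b_{k-1})` (0-based). -/
def dseq (L : LowerPerfectBasis W) (gi : ℕ → D.Iinf) (b : V) (n : ℕ) : ℕ :=
  W.d (gi n) (L.bseq gi b n)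

/-- The highest core `B_H = {b ∈ B : d_{il}(b) = 0 for all (i,l)}`. -/
def BH (L : LowerPerfectBasis W) : Set V := {b ∈ L.B | ∀ x, W.d x b = 0}

/-- The iterated crystal map `𝐟_{i_1l_1}^{a_1} ⋯ 𝐟_{i_rl_r}^{a_r}` (0-based). -/
def floSeq (L : LowerPerfectBasis W) (gi : ℕ → D.Iinf) (a : ℕ → ℕ) (r : ℕ) : V → V :=
  Nat.rec (motive := fun _ => V → V) id
    (fun n F => fun b => F ((L.flo (gi n))^[a n] b)) r

/-- The iterated crystal map `𝐞_{i_rl_r}^{a_r} ⋯ 𝐞_{i_1l_1}^{a_1}` (0-based). -/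
def eloSeq (L : LowerPerfectBasis W) (gi : ℕ → D.Iinf) (a : ℕ → ℕ) (r : ℕ) : V → V :=
  Nat.rec (motive := fun _ => V → V) id
    (fun n F => fun b => (L.elo (gi n))^[a n] (F b)) r

end LowerPerfectBasis

/-- A weak upper perfect space: like a weak lower perfect space, but the
endomorphisms `e x = 𝚎_{il}` raise the weight by `l·α_i`. -/
structure WeakUpperPerfect {I P : Type*} [AddCommGroup P] (D : BCDatum I P)
    (k : Type*) [Field k] (V : Type*) [AddCommGroup V] [Module k V] where
  wtSp : P → Submodule k V
  wt_indep : iSupIndep wtSp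
  wt_total : ⨆ μ, wtSp μ = ⊤
  wt_findim : ∀ μ, FiniteDimensional k (wtSp μ)
  wt_bdd : ∃ Λ : Finset P, ∀ μ, wtSp μ ≠ ⊥ → ∃ lam ∈ Λ, ∃ β ∈ D.Rplus, μ = lam - β
  e : D.Iinf → Module.End k V
  e_wt : ∀ x μ, ∀ v ∈ wtSp μ, e x v ∈ wtSp (μ + D.wtOf x)

namespace WeakUpperPerfect

variable {I P : Type*} [AddCommGroup P] {D : BCDatum I P}
  {k : Type*} [Field k] {V : Type*} [AddCommGroup V] [Module k V]

/-- `d^∨_{il}(v) = max{n ≥ 0 : 𝚎_{il}^n v ≠ 0}`. -/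
def dv (W : WeakUpperPerfect D k V) (x : D.Iinf) (v : V) : ℕ :=
  sSup {n | (W.e x ^ n) v ≠ 0}

end WeakUpperPerfect

/-- An upper perfect basis of a weak upper perfect space. -/
structure UpperPerfectBasis {I P : Type*} [AddCommGroup P] {D : BCDatum I P}
    {k : Type*} [Field k] {V : Type*} [AddCommGroup V] [Module k V]
    (W : WeakUpperPerfect D k V) where
  B : Set V
  linIndep : LinearIndependent k (Subtype.val : B → V)
  spans : Submodule.span k B = ⊤
  graded : ∀ b ∈ B, ∃ μ, b ∈ W.wtSp μ
  Elo : D.Iinf → V → V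
  Elo_zero : ∀ x, ∀ b ∈ B, W.dv x b = 0 → Elo x b = 0
  Elo_mem : ∀ x, ∀ b ∈ B, 0 < W.dv x b → Elo x b ∈ B
  Elo_approx : ∀ x, ∀ b ∈ B, 0 < W.dv x b → ∃ c : k, c ≠ 0 ∧
    W.e x b - c • Elo x b ∈ LinearMap.ker (W.e x ^ (W.dv x b - 1))
  Elo_joint_inj : ∀ b ∈ B, ∀ b' ∈ B, (∀ x, Elo x b = Elo x b') → b = b'

/-- A bilinear pairing realizing `V'` as the graded dual of the weak lower perfect
space `V`, with `𝚎_{il}` adjoint to `𝚏_{il}`. -/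
structure IsGradedDualPair {I P : Type*} [AddCommGroup P] {D : BCDatum I P}
    {k : Type*} [Field k] {V V' : Type*} [AddCommGroup V] [Module k V]
    [AddCommGroup V'] [Module k V']
    (W : WeakLowerPerfect D k V) (W' : WeakUpperPerfect D k V')
    (pr : V →ₗ[k] V' →ₗ[k] k) : Prop where
  orth : ∀ μ ν, μ ≠ ν → ∀ u ∈ W.wtSp μ, ∀ v ∈ W'.wtSp ν, pr u v = 0
  nondeg : ∀ μ, ∀ v ∈ W'.wtSp μ, (∀ u ∈ W.wtSp μ, pr u v = 0) → v = 0
  onto_dual : ∀ μ, ∀ φ : Module.Dual k (W.wtSp μ), ∃ v ∈ W'.wtSp μ,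
      ∀ u : W.wtSp μ, pr (↑u) v = φ u
  adjoint : ∀ x (u : V) (v : V'), pr u (W'.e x v) = pr (W.f x u) v

open Classical in
/-- `dB` sends each `b ∈ B` to the corresponding dual basis vector `b^∨`
(characterized by `⟨b'', b^∨⟩ = δ_{b'' b}` and living in the dual weight space). -/
def IsDualFamily {I P : Type*} [AddCommGroup P] {D : BCDatum I P}
    {k : Type*} [Field k] {V V' : Type*} [AddCommGroup V] [Module k V]
    [AddCommGroup V'] [Module k V']
    (W : WeakLowerPerfect D k V) (W' : WeakUpperPerfect D k V')
    (pr : V →ₗ[k] V' →ₗ[k] k) (B : Set V) (dB : V → V') : Prop :=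
  (∀ b ∈ B, ∀ b' ∈ B, pr b' (dB b) = if b' = b then (1 : k) else 0) ∧
  (∀ b ∈ B, ∀ μ, b ∈ W.wtSp μ → dB b ∈ W'.wtSp μ)


theorem BCDatum.exists_wtOf_eq {I P : Type*} [AddCommGroup P] (D : BCDatum I P) (x : D.Iinf) :
    ∃ (i : I) (l : ℕ), 0 < l ∧ D.wtOf x = l • D.α i := by
  rcases x with i | p
  · exact ⟨i.1, 1, one_pos, by simp [BCDatum.wtOf]⟩
  · exact ⟨p.1.1, p.2, p.2.pos, by simp [BCDatum.wtOf]⟩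

/-- Only finitely many multiples of a positive root can be subtracted while staying in `R_+`. -/
theorem BCDatum.exists_forall_sub_nsmul_notMem_Rplus {I P : Type*} [AddCommGroup P]
    (D : BCDatum I P) (x : D.Iinf) (μ : P) :
    ∃ M : ℕ, ∀ N, M ≤ N → μ - N • D.wtOf x ∉ D.Rplus := by
  classical
  obtain ⟨i, l, hl, hx⟩ := D.exists_wtOf_eq x
  by_cases h : ∃ N₀ : ℕ, μ - N₀ • D.wtOf x ∈ D.Rplus
  · obtain ⟨N₀, c₀, h₀⟩ := h
    refine ⟨N₀ + c₀ i + 1, fun N hN ⟨c, hc⟩ => ?_⟩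
    have hlin : LinearIndependent ℕ D.α := D.roots_indep.restrict_scalars' ℕ
    have key : Finsupp.linearCombination ℕ D.α (Finsupp.single i (N * l) + c) =
        Finsupp.linearCombination ℕ D.α (Finsupp.single i (N₀ * l) + c₀) := by
      rw [map_add, map_add, Finsupp.linearCombination_single, Finsupp.linearCombination_single,
        Finsupp.linearCombination_apply, Finsupp.linearCombination_apply, ← hc, ← h₀, hx,
        mul_smul, mul_smul]
      abel
    have hi := DFunLike.congr_fun (hlin key) i
    simp only [Finsupp.add_apply, Finsupp.single_eq_same] at hi
    nlinarith
  · exact ⟨0, fun N _ hN => h ⟨N, hN⟩⟩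

namespace WeakLowerPerfect

variable {I P : Type*} [AddCommGroup P] {D : BCDatum I P}
  {k : Type*} [Field k] {V : Type*} [AddCommGroup V] [Module k V] (W : WeakLowerPerfect D k V)

theorem isCompl_wtSp (ν : P) : IsCompl (W.wtSp ν) (⨆ μ, ⨆ _ : μ ≠ ν, W.wtSp μ) := by
  refine ⟨W.wt_indep ν, codisjoint_iff.mpr (top_le_iff.mp ?_)⟩
  rw [← W.wt_total]
  refine iSup_le fun μ => ?_
  by_cases h : μ = ν
  · exact h ▸ le_sup_left
  · exact le_sup_of_le_right (le_iSup₂_of_le μ h le_rfl)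

/-- The projection of `V` onto the weight space `V_ν` along the other weight spaces. -/
def wtProj (ν : P) : Module.End k V := Submodule.projection _ _ (W.isCompl_wtSp ν)

theorem wtProj_of_mem {ν : P} {v : V} (hv : v ∈ W.wtSp ν) : W.wtProj ν v = v :=
  Submodule.projection_apply_left (W.isCompl_wtSp ν) ⟨v, hv⟩

theorem wtProj_of_mem_ne {μ ν : P} (h : μ ≠ ν) {v : V} (hv : v ∈ W.wtSp μ) :
    W.wtProj ν v = 0 :=
  (Submodule.projection_apply_eq_zero_iff (W.isCompl_wtSp ν)).mpr
    (le_iSup₂_of_le (f := fun μ (_ : μ ≠ ν) => W.wtSp μ) μ h le_rfl hv)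

theorem pow_f_mem (x : D.Iinf) (n : ℕ) {μ : P} {v : V} (hv : v ∈ W.wtSp μ) :
    (W.f x ^ n) v ∈ W.wtSp (μ - n • D.wtOf x) := by
  induction n with
  | zero => simpa using hv
  | succ n ih =>
    rw [pow_succ', Module.End.mul_apply, succ_nsmul, ← sub_sub]
    exact W.f_wt x _ _ ih

theorem exists_wtSp_add_eq_bot (x : D.Iinf) (ν : P) :
    ∃ M : ℕ, ∀ N, M ≤ N → W.wtSp (ν + N • D.wtOf x) = ⊥ := by
  obtain ⟨Λ, hΛ⟩ := W.wt_bdd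
  choose M hM using fun lam : P => D.exists_forall_sub_nsmul_notMem_Rplus x (lam - ν)
  refine ⟨Λ.sup M, fun N hN => ?_⟩
  by_contra hne
  obtain ⟨lam, hlam, β, hβ, h⟩ := hΛ _ hne
  refine hM lam N ((Finset.le_sup hlam).trans hN) ?_
  rwa [sub_sub, h, sub_sub_cancel]

theorem exists_wtProj_pow_f_eq_zero (x : D.Iinf) (ν : P) :
    ∃ M : ℕ, ∀ v ∈ LinearMap.range (W.f x ^ M), W.wtProj ν v = 0 := by
  obtain ⟨M, hM⟩ := W.exists_wtSp_add_eq_bot x ν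
  refine ⟨M, ?_⟩
  rintro _ ⟨u, rfl⟩
  have hu : u ∈ ⨆ μ, W.wtSp μ := W.wt_total ▸ Submodule.mem_top
  induction hu using Submodule.iSup_induction' with
  | zero => simp
  | add u v _ _ hu hv => rw [map_add, map_add, hu, hv, add_zero]
  | mem μ u hu =>
    by_cases h : μ - M • D.wtOf x = ν
    · have hμ : μ = ν + M • D.wtOf x := by rw [← h, sub_add_cancel]
      rw [hμ, hM M le_rfl, Submodule.mem_bot] at hu
      simp [hu]
    · exact W.wtProj_of_mem_ne h (W.pow_f_mem x M hu)

theorem range_pow_f_antitone (x : D.Iinf) : Antitone fun n => LinearMap.range (W.f x ^ n) :=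
  antitone_nat_of_succ_le fun n => by
    rw [pow_succ, Module.End.mul_eq_comp]
    exact LinearMap.range_comp_le_range _ _

theorem bddAbove_mem_range_pow (x : D.Iinf) {ν : P} {v : V} (hv : v ∈ W.wtSp ν) (h0 : v ≠ 0) :
    BddAbove {n | v ∈ LinearMap.range (W.f x ^ n)} := by
  obtain ⟨M, hM⟩ := W.exists_wtProj_pow_f_eq_zero x ν
  refine ⟨M, fun n hn => le_of_not_gt fun h => h0 ?_⟩
  rw [← W.wtProj_of_mem hv]
  exact hM v (W.range_pow_f_antitone x h.le hn)

theorem mem_range_pow_d (x : D.Iinf) {ν : P} {v : V} (hv : v ∈ W.wtSp ν) (h0 : v ≠ 0) :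
    v ∈ LinearMap.range (W.f x ^ W.d x v) :=
  Nat.sSup_mem (s := {n | v ∈ LinearMap.range (W.f x ^ n)}) ⟨0, by simp⟩
    (W.bddAbove_mem_range_pow x hv h0)

theorem le_d (x : D.Iinf) {ν : P} {v : V} (hv : v ∈ W.wtSp ν) (h0 : v ≠ 0) {n : ℕ}
    (hn : v ∈ LinearMap.range (W.f x ^ n)) : n ≤ W.d x v :=
  le_csSup (W.bddAbove_mem_range_pow x hv h0) hn

theorem f_mem_range_pow_succ (x : D.Iinf) {n : ℕ} {v : V}
    (hv : v ∈ LinearMap.range (W.f x ^ n)) : W.f x v ∈ LinearMap.range (W.f x ^ (n + 1)) := by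
  obtain ⟨u, rfl⟩ := hv
  exact ⟨u, by rw [pow_succ', Module.End.mul_apply]⟩

end WeakLowerPerfect

namespace LowerPerfectBasis

variable {I P : Type*} [AddCommGroup P] {D : BCDatum I P}
  {k : Type*} [Field k] {V : Type*} [AddCommGroup V] [Module k V]
  {W : WeakLowerPerfect D k V} (L : LowerPerfectBasis W) (x : D.Iinf)

theorem ne_zero_of_mem {b : V} (hb : b ∈ L.B) : b ≠ 0 :=
  L.linIndep.ne_zero ⟨b, hb⟩

theorem flo_mem_range {b : V} (hb : b ∈ L.B) {n : ℕ}
    (hn : b ∈ LinearMap.range (W.f x ^ n)) :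
    L.flo x b ∈ LinearMap.range (W.f x ^ (n + 1)) := by
  obtain ⟨ν, hν⟩ := L.graded b hb
  have h0 := L.ne_zero_of_mem hb
  have hd := W.le_d x hν h0 hn
  obtain ⟨c, hc, happ⟩ := L.flo_approx x b hb
  refine W.range_pow_f_antitone x (Nat.succ_le_succ hd) ?_
  rw [← Submodule.smul_mem_iff _ hc, ← sub_sub_self (W.f x b) (c • L.flo x b)]
  exact Submodule.sub_mem _ (W.f_mem_range_pow_succ x (W.mem_range_pow_d x hν h0))
    (W.range_pow_f_antitone x (Nat.le_succ _) happ)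

theorem iterate_flo_mem (n : ℕ) {b : V} (hb : b ∈ L.B) :
    (L.flo x)^[n] b ∈ L.B ∨ (L.flo x)^[n] b = 0 := by
  induction n with
  | zero => exact Or.inl hb
  | succ n ih =>
    rw [iterate_succ_apply']
    rcases ih with h | h
    · exact L.flo_mem x _ h
    · exact Or.inr (by rw [h, L.flo_zero])

theorem iterate_flo_mem_range (n : ℕ) {b : V} (hb : b ∈ L.B) :
    (L.flo x)^[n] b ∈ LinearMap.range (W.f x ^ n) := by
  induction n with
  | zero => simp
  | succ n ih =>
    rw [iterate_succ_apply']
    rcases L.iterate_flo_mem x n hb with h | h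
    · exact L.flo_mem_range x h ih
    · rw [h, L.flo_zero]
      exact Submodule.zero_mem _

theorem span_iterate_flo_antitone :
    Antitone fun n => Submodule.span k ((L.flo x)^[n] '' L.B) := by
  refine antitone_nat_of_succ_le fun n => Submodule.span_le.mpr ?_
  rintro _ ⟨b, hb, rfl⟩
  rcases L.flo_mem x b hb with h | h
  · exact Submodule.subset_span ⟨L.flo x b, h, rfl⟩
  · rw [iterate_succ_apply, h, iterate_fixed (L.flo_zero x)]
    exact Submodule.zero_mem _

theorem range_pow_le_span_sup_succ (n : ℕ) :
    LinearMap.range (W.f x ^ n) ≤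
      Submodule.span k ((L.flo x)^[n] '' L.B) ⊔ LinearMap.range (W.f x ^ (n + 1)) := by
  induction n with
  | zero => simp [L.spans]
  | succ n ih =>
    have hmap : LinearMap.range (W.f x ^ (n + 1)) =
        (LinearMap.range (W.f x ^ n)).map (W.f x) := by
      rw [pow_succ', Module.End.mul_eq_comp, LinearMap.range_comp]
    rw [hmap]
    refine (Submodule.map_mono ih).trans ?_
    rw [Submodule.map_sup, Submodule.map_span]
    refine sup_le (Submodule.span_le.mpr ?_) (le_sup_of_le_right ?_)
    · rintro _ ⟨_, ⟨b, hb, rfl⟩, rfl⟩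
      rcases L.iterate_flo_mem x n hb with h | h
      · obtain ⟨ν, hν⟩ := L.graded _ h
        have hd := W.le_d x hν (L.ne_zero_of_mem h) (L.iterate_flo_mem_range x n hb)
        obtain ⟨c, -, happ⟩ := L.flo_approx x _ h
        rw [SetLike.mem_coe, ← add_sub_cancel (c • L.flo x ((L.flo x)^[n] b)) (W.f x _)]
        refine Submodule.add_mem_sup (Submodule.smul_mem _ _ (Submodule.subset_span
          ⟨b, hb, iterate_succ_apply' _ _ _⟩)) (W.range_pow_f_antitone x ?_ happ)
        lia
      · rw [h, map_zero]
        exact Submodule.zero_mem _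
    · rintro _ ⟨v, hv, rfl⟩
      exact W.f_mem_range_pow_succ x hv

theorem range_pow_le_span_sup (n m : ℕ) :
    LinearMap.range (W.f x ^ n) ≤
      Submodule.span k ((L.flo x)^[n] '' L.B) ⊔ LinearMap.range (W.f x ^ (n + m)) := by
  induction m with
  | zero => exact le_sup_right
  | succ m ih =>
    refine ih.trans (sup_le le_sup_left ((L.range_pow_le_span_sup_succ x (n + m)).trans ?_))
    exact sup_le_sup_right (L.span_iterate_flo_antitone x (Nat.le_add_right n m)) _

theorem wtProj_mem_span_iterate_flo (n : ℕ) (ν : P) {v : V}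
    (hv : v ∈ Submodule.span k ((L.flo x)^[n] '' L.B)) :
    W.wtProj ν v ∈ Submodule.span k ((L.flo x)^[n] '' L.B) := by
  revert v
  change _ ≤ (Submodule.span k ((L.flo x)^[n] '' L.B)).comap (W.wtProj ν)
  refine Submodule.span_le.mpr ?_
  rintro _ ⟨b, hb, rfl⟩
  change W.wtProj ν ((L.flo x)^[n] b) ∈ Submodule.span k ((L.flo x)^[n] '' L.B)
  rcases L.iterate_flo_mem x n hb with h | h
  · obtain ⟨μ, hμ⟩ := L.graded _ h
    by_cases hμν : μ = ν
    · subst hμν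
      rw [W.wtProj_of_mem hμ]
      exact Submodule.subset_span ⟨b, hb, rfl⟩
    · rw [W.wtProj_of_mem_ne hμν hμ]
      exact Submodule.zero_mem _
  · rw [h, map_zero]
    exact Submodule.zero_mem _

theorem span_iterate_flo (n : ℕ) :
    Submodule.span k ((L.flo x)^[n] '' L.B) = LinearMap.range (W.f x ^ n) := by
  refine le_antisymm (Submodule.span_le.mpr ?_) ?_
  · rintro _ ⟨b, hb, rfl⟩
    exact L.iterate_flo_mem_range x n hb
  · rintro _ ⟨u, rfl⟩
    have hu : u ∈ ⨆ μ, W.wtSp μ := W.wt_total ▸ Submodule.mem_top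
    induction hu using Submodule.iSup_induction' with
    | zero => simp
    | add u v _ _ hu hv =>
      rw [map_add]
      exact Submodule.add_mem _ hu hv
    | mem μ u hu =>
      obtain ⟨M, hM⟩ := W.exists_wtProj_pow_f_eq_zero x (μ - n • D.wtOf x)
      obtain ⟨s, hs, r, hr, hsr⟩ :=
        Submodule.mem_sup.mp (L.range_pow_le_span_sup x n M ⟨u, rfl⟩)
      rw [← W.wtProj_of_mem (W.pow_f_mem x n hu), ← hsr, map_add,
        hM r (W.range_pow_f_antitone x (Nat.le_add_left M n) hr), add_zero]
      exact L.wtProj_mem_span_iterate_flo x n _ hs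

end LowerPerfectBasis

/-- `𝚏_{il}^n V = ⊕_{b ∈ 𝐟_{il}^n(B)\{0}} k·b`. -/
theorem statement1 {I P : Type*} [AddCommGroup P] {D : BCDatum I P}
    {k V : Type*} [Field k] [AddCommGroup V] [Module k V]
    (W : WeakLowerPerfect D k V) (L : LowerPerfectBasis W)
    (x : D.Iinf) (n : ℕ) :
    LinearIndependent k
      (Subtype.val : ((L.flo x)^[n] '' L.B \ {0} : Set V) → V) ∧
    Submodule.span k ((L.flo x)^[n] '' L.B \ {0}) = LinearMap.range (W.f x ^ n) := by
  refine ⟨LinearIndepOn.mono (v := id) L.linIndep ?_, ?_⟩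
  · rintro _ ⟨⟨b, hb, rfl⟩, h0⟩
    exact (L.iterate_flo_mem x n hb).resolve_right h0
  · rw [Submodule.span_sdiff_singleton_zero, L.span_iterate_flo]

end
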